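/- arXiv:1008.0713 — 4 statements merged into one kernel-verified Lean document; each statement's English description precedes it below -/
import Mathlib

section
/- The function d(m,n) := ‖m−n‖ is a metric on ℤ; that is, d(m,n) ≥ 0 with d(m,n) = 0 if and only if m = n, d(m,n) = d(n,m), and d(m,n) ≤ d(m,l) + d(l,n) for all l, m, n ∈ ℤ. -/
/-- `fnorm n` : the reciprocal of the largest `k ≥ 1` such that `1, …, k` all divide `n`,
with `fnorm 0 = 0`. -/
noncomputable def fnorm (n : ℤ) : ℝ :=
  if n = 0 then 0
  else 1 / ((sSup {k : ℕ | 1 ≤ k ∧ ∀ j : ℕ, 1 ≤ j → j ≤ k → (j : ℤ) ∣ n} : ℕ) : ℝ)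

/-- The induced distance function `d(m,n) = ‖m - n‖`. -/
noncomputable def fdist (m n : ℤ) : ℝ := fnorm (m - n)

/-- The initial-divisor set of a nonzero integer has a greatest element, whose reciprocal is
the norm. -/
theorem exists_isGreatest_fnorm_eq {n : ℤ} (hn : n ≠ 0) :
    ∃ k : ℕ, IsGreatest {k : ℕ | 1 ≤ k ∧ ∀ j : ℕ, 1 ≤ j → j ≤ k → (j : ℤ) ∣ n} k ∧
      fnorm n = 1 / (k : ℝ) := by
  have hbdd : BddAbove {k : ℕ | 1 ≤ k ∧ ∀ j : ℕ, 1 ≤ j → j ≤ k → (j : ℤ) ∣ n} :=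
    ⟨n.natAbs, fun k hk => Nat.le_of_dvd (Int.natAbs_pos.mpr hn)
      (Int.natCast_dvd.mp (hk.2 k hk.1 le_rfl))⟩
  have hne : {k : ℕ | 1 ≤ k ∧ ∀ j : ℕ, 1 ≤ j → j ≤ k → (j : ℤ) ∣ n}.Nonempty := by
    refine ⟨1, le_rfl, fun j h1 h2 => ?_⟩
    obtain rfl : j = 1 := le_antisymm h2 h1
    simp
  exact ⟨_, ⟨Nat.sSup_mem hne hbdd, fun k hk => le_csSup hbdd hk⟩, if_neg hn⟩

theorem fnorm_zero : fnorm 0 = 0 := if_pos rfl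

theorem fnorm_pos {n : ℤ} (hn : n ≠ 0) : 0 < fnorm n := by
  obtain ⟨k, hk, h⟩ := exists_isGreatest_fnorm_eq hn
  have : 0 < k := hk.1.1
  rw [h]
  positivity

theorem fnorm_nonneg (n : ℤ) : 0 ≤ fnorm n := by
  rcases eq_or_ne n 0 with rfl | hn
  · exact fnorm_zero.ge
  · exact (fnorm_pos hn).le

theorem fnorm_eq_zero_iff {n : ℤ} : fnorm n = 0 ↔ n = 0 :=
  ⟨fun h => by_contra fun hn => (fnorm_pos hn).ne' h, fun h => h ▸ fnorm_zero⟩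

theorem fnorm_neg (n : ℤ) : fnorm (-n) = fnorm n := by
  simp only [fnorm, neg_eq_zero, dvd_neg]

/-- The norm is non-archimedean. -/
theorem fnorm_add_le_max (a b : ℤ) : fnorm (a + b) ≤ max (fnorm a) (fnorm b) := by
  rcases eq_or_ne a 0 with rfl | ha
  · simp
  rcases eq_or_ne b 0 with rfl | hb
  · simp
  rcases eq_or_ne (a + b) 0 with hab | hab
  · rw [hab, fnorm_zero]
    exact le_max_of_le_left (fnorm_nonneg a)
  obtain ⟨k, hk, hka⟩ := exists_isGreatest_fnorm_eq ha
  obtain ⟨l, hl, hlb⟩ := exists_isGreatest_fnorm_eq hb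
  obtain ⟨m, hm, hmab⟩ := exists_isGreatest_fnorm_eq hab
  have hk0 : 1 ≤ k := hk.1.1
  have hl0 : 1 ≤ l := hl.1.1
  have hmin : min k l ≤ m := hm.2 ⟨le_min hk0 hl0, fun j h1 h2 =>
    dvd_add (hk.1.2 j h1 (h2.trans (min_le_left k l))) (hl.1.2 j h1 (h2.trans (min_le_right k l)))⟩
  rw [hka, hlb, hmab, le_max_iff]
  rcases min_le_iff.mp hmin with h | h
  · exact Or.inl (one_div_le_one_div_of_le (by exact_mod_cast hk0) (by exact_mod_cast h))
  · exact Or.inr (one_div_le_one_div_of_le (by exact_mod_cast hl0) (by exact_mod_cast h))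

/-- The function `d(m,n) = ‖m-n‖` is a metric on ℤ. -/
theorem fdist_is_metric :
    (∀ m n : ℤ, 0 ≤ fdist m n) ∧
    (∀ m n : ℤ, fdist m n = 0 ↔ m = n) ∧
    (∀ m n : ℤ, fdist m n = fdist n m) ∧
    (∀ l m n : ℤ, fdist m n ≤ fdist m l + fdist l n) := by
  refine ⟨fun m n => fnorm_nonneg _, fun m n => fnorm_eq_zero_iff.trans sub_eq_zero,
    fun m n => ?_, fun l m n => ?_⟩
  · rw [fdist, fdist, ← fnorm_neg, neg_sub]
  · have h := fnorm_add_le_max (m - l) (l - n)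
    rw [sub_add_sub_cancel] at h
    exact h.trans (max_le_add_of_nonneg (fnorm_nonneg _) (fnorm_nonneg _))
end

section
/- If the set of prime numbers were finite, say equal to {p₁, …, p_k}, then the union C := p₁ℤ ∪ ⋯ ∪ p_kℤ would be a closed set in the Fürstenberg topology whose complement is {−1, 1}; since {−1, 1} is not open in T, the set of prime numbers is infinite. Formally: the set of prime numbers is infinite, and ℤ ∖ {−1, 1} equals the union over all primes p of pℤ. -/
/-- The arithmetic progression `a + bℤ`. -/
def ap (a : ℤ) (b : ℕ) : Set ℤ := {x : ℤ | ∃ n : ℤ, x = a + b * n}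

/-- A set is open in Fürstenberg's sense if each of its points is contained
in an arithmetic progression lying inside the set. -/
def FurstOpen (A : Set ℤ) : Prop := ∀ a ∈ A, ∃ b : ℕ, 1 ≤ b ∧ ap a b ⊆ A

/-- Fürstenberg's topology on ℤ. -/
def T : TopologicalSpace ℤ where
  IsOpen := FurstOpen
  isOpen_univ := fun a _ => ⟨1, le_refl 1, fun _ _ => trivial⟩
  isOpen_inter := by
    rintro s t hs ht a ⟨has, hat⟩
    obtain ⟨b, hb, hbs⟩ := hs a has
    obtain ⟨c, hc, hct⟩ := ht a hat
    refine ⟨b * c, Nat.one_le_iff_ne_zero.2 (Nat.mul_ne_zero (by omega) (by omega)), ?_⟩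
    rintro x ⟨n, hn⟩
    exact ⟨hbs ⟨(c : ℤ) * n, by rw [hn]; push_cast; ring⟩,
           hct ⟨(b : ℤ) * n, by rw [hn]; push_cast; ring⟩⟩
  isOpen_sUnion := by
    rintro S hS a ⟨s, hsS, has⟩
    obtain ⟨b, hb, hsub⟩ := hS s hsS a has
    exact ⟨b, hb, fun x hx => ⟨s, hsS, hsub hx⟩⟩

open scoped Topology

lemma mem_ap_iff_dvd {a x : ℤ} {b : ℕ} : x ∈ ap a b ↔ (b : ℤ) ∣ x - a :=
  exists_congr fun _ => eq_comm.trans (by constructor <;> intro h <;> linarith)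

/-- Arithmetic progressions with positive difference are closed. -/
lemma isClosed_ap (a : ℤ) {b : ℕ} (hb : 1 ≤ b) : IsClosed[T] (ap a b) := by
  refine (@isOpen_compl_iff _ _ T).1 fun x hx => ⟨b, hb, fun y hy hya => hx ?_⟩
  rw [mem_ap_iff_dvd] at hy hya ⊢
  simpa using dvd_sub hya hy

/-- A nonempty open set is infinite. -/
lemma infinite_of_isOpen {A : Set ℤ} (hA : IsOpen[T] A) (hne : A.Nonempty) : A.Infinite := by
  obtain ⟨a, ha⟩ := hne
  obtain ⟨b, hb, hsub⟩ := hA a ha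
  have hb0 : (b : ℤ) ≠ 0 := by omega
  refine (Set.infinite_range_of_injective (f := fun n : ℤ => a + b * n) ?_).mono ?_
  · intro m n h
    exact mul_left_cancel₀ hb0 (add_left_cancel h)
  · rintro _ ⟨n, rfl⟩
    exact hsub ⟨n, rfl⟩

/-- The integers other than `-1` and `1` are those divisible by some prime. -/
lemma compl_units_eq_iUnion_ap :
    ({-1, 1} : Set ℤ)ᶜ = ⋃ p ∈ {p : ℕ | p.Prime}, ap 0 p := by
  ext x
  have hx : x ∈ ({-1, 1} : Set ℤ)ᶜ ↔ x.natAbs ≠ 1 := by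
    simp only [Set.mem_compl_iff, Set.mem_insert_iff, Set.mem_singleton_iff]
    omega
  simp [hx, Nat.ne_one_iff_exists_prime_dvd, mem_ap_iff_dvd, Int.natCast_dvd]

/-- Fürstenberg: the set of primes is infinite, and the complement of `{-1, 1}` in `ℤ`
is the union of the sets `pℤ` over all primes `p`. -/
theorem primes_infinite_furstenberg :
    {p : ℕ | p.Prime}.Infinite ∧
    ({-1, 1} : Set ℤ)ᶜ = ⋃ p ∈ {p : ℕ | p.Prime}, ap 0 p := by
  refine ⟨fun hfin => ?_, compl_units_eq_iUnion_ap⟩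
  have hclosed : IsClosed[T] (({-1, 1} : Set ℤ)ᶜ) := by
    rw [compl_units_eq_iUnion_ap]
    exact @Set.Finite.isClosed_biUnion _ _ T _ _ hfin fun p hp => isClosed_ap 0 hp.one_le
  have hopen : IsOpen[T] ({-1, 1} : Set ℤ) := (@isClosed_compl_iff _ T _).1 hclosed
  exact infinite_of_isOpen hopen ⟨1, by simp⟩ (Set.toFinite _)
end

section
/- Every set of prime numbers is a closed subset of the subspace Z̃ := {n ∈ ℤ : n ≥ 2} equipped with the topology induced by the Fürstenberg topology T. Indeed, for any set A of primes, Z̃ ∖ A = Z̃ ∩ ⋃_{n ∈ Z̃ ∖ A} nℤ, which is relatively open in Z̃. -/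
/-- The subspace `Z̃ = {n ∈ ℤ : n ≥ 2}`. -/
def Ztil : Set ℤ := {n : ℤ | 2 ≤ n}

/-- A union of subgroups `nℤ` with `n ≥ 2` is open in Fürstenberg's topology. -/
theorem isOpen_T_iUnion_multiples {S : Set ℤ} (hS : S ⊆ Ztil) :
    @IsOpen ℤ T (⋃ n ∈ S, {x : ℤ | n ∣ x}) := by
  intro a ha
  simp only [Set.mem_iUnion, Set.mem_ofPred_eq] at ha
  obtain ⟨n, hn, hna⟩ := ha
  have h2 : 2 ≤ n := hS hn
  refine ⟨n.toNat, by omega, ?_⟩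
  rintro _ ⟨k, rfl⟩
  simp only [Set.mem_iUnion, Set.mem_ofPred_eq]
  refine ⟨n, hn, dvd_add hna ?_⟩
  rw [Int.toNat_of_nonneg (by omega)]
  exact dvd_mul_right n k

/-- Removing a set of primes from `Z̃` leaves the multiples of the remaining elements. -/
theorem Ztil_diff_primes_eq {A : Set ℤ} (hA : ∀ p ∈ A, Prime p) :
    Ztil \ A = Ztil ∩ ⋃ n ∈ Ztil \ A, {x : ℤ | n ∣ x} := by
  ext x
  simp only [Set.mem_inter_iff, Set.mem_iUnion, Set.mem_ofPred_eq, exists_prop]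
  refine ⟨fun hx => ⟨hx.1, x, hx, dvd_rfl⟩, ?_⟩
  rintro ⟨hx, n, ⟨hn, hnA⟩, hnx⟩
  refine ⟨hx, fun hxA => hnA ?_⟩
  have hx2 : 2 ≤ x := hx
  have hn2 : 2 ≤ n := hn
  rcases (hA x hxA).irreducible.dvd_iff.1 hnx with hu | ha
  · rcases Int.isUnit_iff.1 hu with h | h <;> omega
  · rcases Int.associated_iff.1 ha with h | h
    · rwa [← h]
    · omega

/-- Every set of (positive) primes is closed in the subspace `Z̃` with the topology
induced by `T`; indeed `Z̃ \ A = Z̃ ∩ ⋃_{n ∈ Z̃ \ A} nℤ`. -/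
theorem primes_closed_in_Ztil (A : Set ℤ) (hA : ∀ p ∈ A, Prime p ∧ 2 ≤ p) :
    @IsClosed Ztil (@instTopologicalSpaceSubtype ℤ (· ∈ Ztil) T)
      {x : Ztil | (x : ℤ) ∈ A} ∧
    Ztil \ A = Ztil ∩ ⋃ n ∈ Ztil \ A, {x : ℤ | n ∣ x} := by
  have heq := Ztil_diff_primes_eq fun p hp => (hA p hp).1
  refine ⟨?_, heq⟩
  let _ := T
  rw [← isOpen_compl_iff]
  refine ⟨_, isOpen_T_iUnion_multiples (S := Ztil \ A) Set.sdiff_subset, ?_⟩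
  ext x
  have hx := Set.ext_iff.1 heq x
  simp only [Set.mem_sdiff, Set.mem_inter_iff, x.2, true_and] at hx
  exact hx.symm
end

section
/- Let A = {p₀, p₁, p₂, …} and B = {q₀, q₁, q₂, …} be two disjoint sets of positive prime numbers (given by enumerations p, q : ℕ → ℤ of primes). Then there exist sequences a₀, a₁, a₂, … and b₀, b₁, b₂, … of positive integers such that A ⊆ ⋃_{i∈ℕ} (pᵢ + aᵢℤ), B ⊆ ⋃_{j∈ℕ} (qⱼ + bⱼℤ), and pᵢ + k·aᵢ ≠ qⱼ + l·bⱼ for all i, j ∈ ℕ and all k, l ∈ ℤ; in other words, the unions of arithmetic progressions ⋃_{i∈ℕ}(pᵢ + aᵢℤ) and ⋃_{j∈ℕ}(qⱼ + bⱼℤ) are disjoint. -/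
/-- Two distinct primes `r` and `s` are never congruent modulo a common divisor of `r !` and `s !`:
the smaller prime divides both factorials but not the larger prime. -/
theorem eq_of_add_mul_factorial_eq {r s : ℤ} (hr : Prime r) (hr2 : 2 ≤ r) (hs : Prime s)
    (hrs : r ≤ s) {k l : ℤ}
    (h : r + k * (r.toNat.factorial : ℤ) = s + l * (s.toNat.factorial : ℤ)) : r = s := by
  have dvd_factorial (t : ℤ) (hrt : r ≤ t) : r ∣ (t.toNat.factorial : ℤ) := by
    have := Nat.dvd_factorial (m := r.toNat) (n := t.toNat) (by omega) (by omega)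
    rw [← Int.toNat_of_nonneg (show 0 ≤ r by omega)]
    exact_mod_cast this
  have hdvd : r ∣ s := by
    rw [show s = r + k * (r.toNat.factorial : ℤ) - l * (s.toNat.factorial : ℤ) by linarith]
    exact dvd_sub (dvd_add dvd_rfl ((dvd_factorial r le_rfl).mul_left k))
      ((dvd_factorial s hrs).mul_left l)
  exact Int.eq_of_associated_of_nonneg ((hr.dvd_prime_iff_associated hs).1 hdvd)
    (by omega) (by omega)

/-- Any two disjoint sets of positive primes `A = {p₀, p₁, …}` and `B = {q₀, q₁, …}`
can be separated by arithmetic progressions: there are positive integers `aᵢ`, `bⱼ`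
with `A ⊆ ⋃ᵢ (pᵢ + aᵢℤ)`, `B ⊆ ⋃ⱼ (qⱼ + bⱼℤ)`, and `pᵢ + k·aᵢ ≠ qⱼ + l·bⱼ`
for all `i, j, k, l`; i.e. the two unions of progressions are disjoint. -/
theorem primes_separated_by_progressions (p q : ℕ → ℤ)
    (hp : ∀ i, Prime (p i) ∧ 2 ≤ p i) (hq : ∀ j, Prime (q j) ∧ 2 ≤ q j)
    (hdisj : Disjoint (Set.range p) (Set.range q)) :
    ∃ a b : ℕ → ℕ, (∀ i, 1 ≤ a i) ∧ (∀ j, 1 ≤ b j) ∧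
      Set.range p ⊆ ⋃ i, ap (p i) (a i) ∧
      Set.range q ⊆ ⋃ j, ap (q j) (b j) ∧
      ∀ (i j : ℕ) (k l : ℤ), p i + k * (a i : ℤ) ≠ q j + l * (b j : ℤ) := by
  have mem_ap (x : ℤ) (n : ℕ) : x ∈ ap x n := ⟨0, by ring⟩
  refine ⟨fun i => (p i).toNat.factorial, fun j => (q j).toNat.factorial,
    fun i => Nat.factorial_pos _, fun j => Nat.factorial_pos _, ?_, ?_, ?_⟩
  · rintro _ ⟨i, rfl⟩
    exact Set.mem_iUnion.2 ⟨i, mem_ap _ _⟩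
  · rintro _ ⟨j, rfl⟩
    exact Set.mem_iUnion.2 ⟨j, mem_ap _ _⟩
  · intro i j k l h
    apply Set.disjoint_left.1 hdisj (Set.mem_range_self i)
    rcases le_total (p i) (q j) with hle | hle
    · exact ⟨j, (eq_of_add_mul_factorial_eq (hp i).1 (hp i).2 (hq j).1 hle h).symm⟩
    · exact ⟨j, eq_of_add_mul_factorial_eq (hq j).1 (hq j).2 (hp i).1 hle h.symm⟩
end
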